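/- If a poset P admits a containment model by paths in a host tree T of maximum degree Δ ≥ 2 and radius r ≥ 1, then dim(P) ≤ 2⌈log₂ log₂ Δ⌉ + 2⌈log₂ r⌉ + 3. -/

import Mathlib

/-- A containment model of the poset `X` by paths of the graph `G`. -/
def GraphCPTModel {V : Type*} (G : SimpleGraph V) {X : Type*} [PartialOrder X]
    (M : X → Set V) : Prop :=
  (∀ x, ∃ (u v : V) (p : G.Walk u v), p.IsPath ∧ M x = {w | w ∈ p.support}) ∧
  ∀ x y : X, x ≠ y → (x ≤ y ↔ M x ⊂ M y)

/-- The radius of a graph: the least possible eccentricity of a vertex. -/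
noncomputable def graphRadius {V : Type*} (G : SimpleGraph V) : ℕ :=
  sInf {e | ∃ c : V, ∀ v, G.dist c v ≤ e}

/-- `L` is a (non-strict) linear order relation on `X`. -/
def IsLinearOrderRel {X : Type*} (L : X → X → Prop) : Prop :=
  (∀ a, L a a) ∧ (∀ a b, L a b → L b a → a = b) ∧
  (∀ a b c, L a b → L b c → L a c) ∧ (∀ a b, L a b ∨ L b a)

/-- The poset `X` has dimension at most `k`: there are `k` linear extensions of the order
whose intersection is the order. -/
def DimLE (X : Type*) [PartialOrder X] (k : ℕ) : Prop :=
  ∃ L : Fin k → X → X → Prop,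
    (∀ i, IsLinearOrderRel (L i)) ∧ ∀ a b : X, a ≤ b ↔ ∀ i, L i a b

/-- The dimension of the poset `X`. -/
noncomputable def posetDim (X : Type*) [PartialOrder X] : ℕ :=
  sInf {k | DimLE X k}

/-- Complement the entries of a bit string at the positions selected by `s`. -/
def twist : (ℕ → Bool) → List Bool → List Bool
  | _, [] => []
  | s, b :: l => xor b (s 0) :: twist (fun i => s (i + 1)) l

theorem twist_lt_of_prefix (s : ℕ → Bool) {a b : List Bool} (h : a <+: b) (hne : a ≠ b) :
    twist s a < twist s b := by
  induction a generalizing s b with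
  | nil =>
    cases b with
    | nil => exact absurd rfl hne
    | cons y b => simp [twist]
  | cons x a ih =>
    cases b with
    | nil => simp at h
    | cons y b =>
      rw [List.cons_prefix_cons] at h
      obtain ⟨rfl, h⟩ := h
      have hab : a ≠ b := fun e => hne (by rw [e])
      simp only [twist, List.cons_lt_cons_iff]
      exact Or.inr ⟨trivial, ih _ h hab⟩

/-- If two bit strings branch at the position `p.length` and `s` raises the second one there, then
the second one exceeds all proper prefixes of itself among the prefixes of the first. -/
theorem twist_lt_of_branch (s : ℕ → Bool) (p : List Bool) {x : Bool} {a b w : List Bool}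
    (hs : s p.length = x) (hw : w <+: p ++ x :: a) :
    twist s w < twist s (p ++ (!x) :: b) := by
  induction p generalizing s w with
  | nil =>
    cases w with
    | nil => simp [twist]
    | cons y w =>
      rw [List.nil_append, List.cons_prefix_cons] at hw
      obtain ⟨rfl, hw⟩ := hw
      simp only [List.length_nil] at hs
      subst hs
      simp only [List.nil_append, twist, List.cons_lt_cons_iff]
      left
      cases s 0 <;> simp
  | cons q p ih =>
    cases w with
    | nil => simp [twist]
    | cons y w =>
      rw [List.cons_append, List.cons_prefix_cons] at hw
      obtain ⟨rfl, hw⟩ := hw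
      simp only [List.cons_append, twist, List.cons_lt_cons_iff]
      exact Or.inr ⟨trivial, ih _ hs hw⟩

theorem exists_branch_of_length_eq {a b : List Bool} (hl : a.length = b.length) (hne : a ≠ b) :
    ∃ p x a' b', a = p ++ x :: a' ∧ b = p ++ (!x) :: b' := by
  induction a generalizing b with
  | nil =>
    cases b with
    | nil => exact absurd rfl hne
    | cons y b => simp at hl
  | cons x a ih =>
    cases b with
    | nil => simp at hl
    | cons y b =>
      by_cases hxy : x = y
      · subst hxy
        obtain ⟨p, z, a', b', rfl, rfl⟩ := ih (by simpa using hl) (fun e => hne (by rw [e]))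
        exact ⟨x :: p, z, a', b', rfl, rfl⟩
      · refine ⟨[], x, a, b, rfl, ?_⟩
        cases x <;> cases y <;> simp_all

/-- The concatenation of the labels of the consecutive pairs of a list. -/
def pairCode {V : Type*} (lab : V → V → List Bool) : List V → List Bool
  | [] => []
  | [_] => []
  | x :: y :: t => lab x y ++ pairCode lab (y :: t)

section pairCode

variable {V : Type*} {lab : V → V → List Bool} {m : ℕ}

theorem length_pairCode (hlab : ∀ x y, (lab x y).length = m) (x : V) (l : List V) :
    (pairCode lab (x :: l)).length = m * l.length := by
  induction l generalizing x with
  | nil => simp [pairCode]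
  | cons y t ih => simp [pairCode, hlab, ih, Nat.mul_succ, Nat.add_comm]

theorem pairCode_prefix {l₁ l₂ : List V} (h : l₁ <+: l₂) :
    pairCode lab l₁ <+: pairCode lab l₂ := by
  induction l₁ generalizing l₂ with
  | nil => simp [pairCode]
  | cons x l₁ ih =>
    cases l₂ with
    | nil => simp at h
    | cons y l₂ =>
      rw [List.cons_prefix_cons] at h
      obtain ⟨rfl, h⟩ := h
      cases l₁ with
      | nil => simp [pairCode]
      | cons z t =>
        have h' := ih h
        cases l₂ with
        | nil => simp at h
        | cons z' t' =>
          rw [List.cons_prefix_cons] at h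
          obtain ⟨rfl, h⟩ := h
          simpa [pairCode] using h'

theorem pairCode_branch {adj : V → V → Prop} (hlab : ∀ x y, (lab x y).length = m)
    (hinj : ∀ x y z, adj x y → adj x z → lab x y = lab x z → y = z)
    (x : V) (l₁ l₂ : List V) (h₁ : List.IsChain adj (x :: l₁)) (h₂ : List.IsChain adj (x :: l₂)) :
    l₁ <+: l₂ ∨ l₂ <+: l₁ ∨ ∃ p b c₁ c₂, pairCode lab (x :: l₁) = p ++ b :: c₁ ∧
      pairCode lab (x :: l₂) = p ++ (!b) :: c₂ := by
  induction l₁ generalizing x l₂ with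
  | nil => simp
  | cons y l₁ ih =>
    cases l₂ with
    | nil => simp
    | cons z l₂ =>
      rw [List.isChain_cons_cons] at h₁ h₂
      by_cases hyz : y = z
      · subst hyz
        rcases ih y l₂ h₁.2 h₂.2 with h | h | ⟨p, b, c₁, c₂, e₁, e₂⟩
        · exact Or.inl (by simpa [List.cons_prefix_cons] using h)
        · exact Or.inr (Or.inl (by simpa [List.cons_prefix_cons] using h))
        · exact Or.inr (Or.inr ⟨lab x y ++ p, b, c₁, c₂, by simp [pairCode, e₁],
            by simp [pairCode, e₂]⟩)
      · obtain ⟨p, b, c₁, c₂, e₁, e₂⟩ := exists_branch_of_length_eq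
          ((hlab x y).trans (hlab x z).symm) (fun e => hyz (hinj x y z h₁.1 h₂.1 e))
        exact Or.inr (Or.inr ⟨p, b, c₁ ++ pairCode lab (y :: l₁), c₂ ++ pairCode lab (z :: l₂),
          by simp [pairCode, e₁], by simp [pairCode, e₂]⟩)

end pairCode

/-- A family of sign vectors, two for each binary digit and two constant ones. -/
def signVector {K : ℕ} (b : Bool) : Option (Fin K) → ℕ → Bool
  | none, _ => b
  | some k, n => xor b (n.testBit k)

theorem exists_signVector {K n m : ℕ} (hn : n < 2 ^ K) (hm : m < 2 ^ K) (g : ℕ → Bool) :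
    ∃ (b : Bool) (o : Option (Fin K)), signVector b o n = g n ∧ signVector b o m = g m := by
  by_cases hg : g n = g m
  · exact ⟨g n, none, rfl, hg⟩
  · have hnm : n ≠ m := fun e => hg (by rw [e])
    obtain ⟨k, hk⟩ := Nat.exists_testBit_ne_of_ne hnm
    have hkK : k < K := by
      by_contra! hle
      have hpow : 2 ^ K ≤ 2 ^ k := Nat.pow_le_pow_right (by norm_num) hle
      exact hk (by rw [Nat.testBit_lt_two_pow (hn.trans_le hpow),
        Nat.testBit_lt_two_pow (hm.trans_le hpow)])
    refine ⟨xor (g n) (n.testBit k), some ⟨k, hkK⟩, ?_, ?_⟩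
    · simp [signVector]
    · simp only [signVector]
      revert hg hk
      cases g n <;> cases g m <;> cases n.testBit k <;> cases m.testBit k <;> simp

/-- The supports of the paths of a tree from a root `c`. -/
noncomputable def rootSupport {V : Type*} {G : SimpleGraph V} (hT : G.IsTree) (c v : V) : List V :=
  (hT.existsUnique_path c v).choose.support

section rootSupport

variable {V : Type*} {G : SimpleGraph V} (hT : G.IsTree) (c : V)

theorem rootSupport_eq {v : V} (p : G.Walk c v) (hp : p.IsPath) :
    rootSupport hT c v = p.support := by
  rw [rootSupport, ← (hT.existsUnique_path c v).choose_spec.2 p hp]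

theorem exists_path_rootSupport (v : V) :
    ∃ p : G.Walk c v, p.IsPath ∧ rootSupport hT c v = p.support :=
  ⟨_, (hT.existsUnique_path c v).choose_spec.1, rfl⟩

theorem rootSupport_subset {v : V} (p : G.Walk c v) : rootSupport hT c v ⊆ p.support := by
  classical
  rw [rootSupport_eq hT c p.bypass p.bypass_isPath]
  exact p.support_bypass_subset_support

theorem rootSupport_inj {v w : V} (h : rootSupport hT c v = rootSupport hT c w) : v = w := by
  obtain ⟨p, -, hp⟩ := exists_path_rootSupport hT c v
  obtain ⟨q, -, hq⟩ := exists_path_rootSupport hT c w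
  have h₁ := p.getLast_support
  have h₂ := q.getLast_support
  simp only [← hp, ← hq, h] at h₁ h₂
  exact h₁.symm.trans h₂

theorem rootSupport_eq_cons (v : V) :
    ∃ l, rootSupport hT c v = c :: l ∧ List.IsChain G.Adj (c :: l) ∧ l.length = G.dist c v := by
  obtain ⟨p, hp, e⟩ := exists_path_rootSupport hT c v
  refine ⟨p.support.tail, by rw [e, p.cons_tail_support], ?_, ?_⟩
  · rw [p.cons_tail_support]
    exact p.isChain_adj_support
  · obtain ⟨q, hq, hl⟩ := hT.connected.exists_path_of_dist c v
    rw [← hl, hT.existsUnique_path c v |>.unique hp hq]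
    simp

theorem mem_rootSupport_self (v : V) : v ∈ rootSupport hT c v := by
  obtain ⟨p, hp, e⟩ := exists_path_rootSupport hT c v
  simp [e]

theorem rootSupport_prefix {v w : V} (h : v ∈ rootSupport hT c w) :
    rootSupport hT c v <+: rootSupport hT c w := by
  classical
  obtain ⟨p, hp, e⟩ := exists_path_rootSupport hT c w
  rw [e] at h ⊢
  rw [rootSupport_eq hT c (p.takeUntil v h) (hp.takeUntil h)]
  refine ⟨(p.dropUntil v h).support.tail, ?_⟩
  rw [← SimpleGraph.Walk.support_append, p.take_spec h]

theorem mem_rootSupport_or_of_mem_path {u u' w : V} (p : G.Walk u u') (hp : p.IsPath)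
    (hw : w ∈ p.support) : w ∈ rootSupport hT c u ∨ w ∈ rootSupport hT c u' := by
  classical
  obtain ⟨q, -, hq⟩ := exists_path_rootSupport hT c u
  obtain ⟨q', -, hq'⟩ := exists_path_rootSupport hT c u'
  have he := (hT.existsUnique_path u u').unique hp (q.reverse.append q').bypass_isPath
  rw [he] at hw
  have hw' := SimpleGraph.Walk.support_bypass_subset_support _ hw
  rw [SimpleGraph.Walk.mem_support_append_iff] at hw'
  simpa [hq, hq'] using hw'

theorem dist_lt_of_notMem_path {u u' v w : V} (p : G.Walk u u') (hv : v ∈ rootSupport hT c u)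
    (hvp : v ∉ p.support) (hw : w ∈ p.support) : G.dist c v < G.dist c w := by
  classical
  obtain ⟨q, -, hq⟩ := exists_path_rootSupport hT c w
  have hmem := rootSupport_subset hT c (q.append (p.takeUntil w hw).reverse) hv
  rw [SimpleGraph.Walk.mem_support_append_iff, SimpleGraph.Walk.support_reverse,
    List.mem_reverse, ← hq] at hmem
  have hvw : v ∈ rootSupport hT c w :=
    hmem.resolve_right fun h => hvp (p.support_takeUntil_subset_support hw h)
  have hpre := rootSupport_prefix hT c hvw
  have hne : v ≠ w := fun e => hvp (e ▸ hw)
  obtain ⟨l, el, -, hl⟩ := rootSupport_eq_cons hT c v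
  obtain ⟨l', el', -, hl'⟩ := rootSupport_eq_cons hT c w
  have hlen := hpre.length_le
  rw [el, el', List.length_cons, List.length_cons, hl, hl'] at hlen
  refine lt_of_le_of_ne (by omega) fun e => hne (rootSupport_inj hT c (hpre.eq_of_length ?_))
  rw [el, el', List.length_cons, List.length_cons, hl, hl', e]

end rootSupport

/-- A position at which the sign decides that `v` exceeds all vertices of the root path of `u`. -/
theorem exists_position {V : Type*} {G : SimpleGraph V} (hT : G.IsTree) (c : V)
    {lab : V → V → List Bool} {m r N : ℕ} (hm : 0 < m) (hN : r * m ≤ N) (hN0 : 0 < N)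
    (hr : ∀ v, G.dist c v ≤ r) (hlab : ∀ x y, (lab x y).length = m)
    (hinj : ∀ x y z, G.Adj x y → G.Adj x z → lab x y = lab x z → y = z)
    (u v : V) (hv : v ∉ rootSupport hT c u) :
    ∃ n < N, ∀ s : ℕ → Bool, s n = !(pairCode lab (rootSupport hT c v)).getD n false →
      ∀ w ∈ rootSupport hT c u, twist s (pairCode lab (rootSupport hT c w)) <
        twist s (pairCode lab (rootSupport hT c v)) := by
  obtain ⟨l, el, hl, hlen⟩ := rootSupport_eq_cons hT c u
  obtain ⟨l', el', hl', hlen'⟩ := rootSupport_eq_cons hT c v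
  rcases pairCode_branch hlab hinj c l l' hl hl' with h | h | ⟨p, b, c₁, c₂, e₁, e₂⟩
  · refine ⟨0, hN0, fun s _ w hw => ?_⟩
    have hpre : rootSupport hT c w <+: rootSupport hT c v :=
      (rootSupport_prefix hT c hw).trans
        (by rw [el, el', List.cons_prefix_cons]; exact ⟨rfl, h⟩)
    refine twist_lt_of_prefix s (pairCode_prefix hpre) fun e => hv ?_
    obtain ⟨l'', el'', -, -⟩ := rootSupport_eq_cons hT c w
    have hlen2 := congrArg List.length e
    rw [el', el'', length_pairCode hlab, length_pairCode hlab] at hlen2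
    have hlen3 := Nat.eq_of_mul_eq_mul_left hm hlen2
    have : w = v := rootSupport_inj hT c (hpre.eq_of_length (by rw [el', el'']; simp [hlen3]))
    exact this ▸ hw
  · refine absurd ?_ hv
    have hpre : rootSupport hT c v <+: rootSupport hT c u := by
      rw [el, el', List.cons_prefix_cons]; exact ⟨rfl, h⟩
    exact hpre.subset (mem_rootSupport_self hT c v)
  · have hlt := congrArg List.length e₁
    rw [length_pairCode hlab, hlen, List.length_append, List.length_cons] at hlt
    have hb : m * G.dist c u ≤ N := (Nat.mul_le_mul_left m (hr u)).trans (by rwa [Nat.mul_comm])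
    refine ⟨p.length, by omega, fun s hs w hw => ?_⟩
    rw [el', e₂] at hs ⊢
    have hpre := pairCode_prefix (lab := lab) (rootSupport_prefix hT c hw)
    rw [el, e₁] at hpre
    exact twist_lt_of_branch s p (by simpa [List.getD] using hs) hpre

/-- Labels of a fixed length that separate the neighbours of each vertex. -/
theorem exists_labels {V : Type*} [Fintype V] (G : SimpleGraph V) [DecidableRel G.Adj] {m : ℕ}
    (h : G.maxDegree ≤ 2 ^ m) :
    ∃ lab : V → V → List Bool, (∀ x y, (lab x y).length = m) ∧
      ∀ x y z, G.Adj x y → G.Adj x z → lab x y = lab x z → y = z := by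
  classical
  have hemb : ∀ x, Nonempty (G.neighborSet x ↪ (Fin m → Bool)) := fun x =>
    Function.Embedding.nonempty_of_card_le (by
      rw [SimpleGraph.card_neighborSet_eq_degree]
      simpa using (G.degree_le_maxDegree x).trans h)
  let f := fun x => (hemb x).some
  refine ⟨fun x y => if hxy : G.Adj x y then List.ofFn (f x ⟨y, hxy⟩) else
    List.replicate m false, fun x y => ?_, fun x y z hy hz e => ?_⟩
  · dsimp only
    split_ifs <;> simp
  · simp only [hy, hz, dif_pos] at e
    exact congrArg Subtype.val ((f x).injective (List.ofFn_injective e))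

/-- Every vertex weighting into a linear order on a finite type is strictly
represented by a natural-valued one. -/
theorem exists_rank {V α : Type*} [Finite V] [LinearOrder α] (f : V → α) :
    ∃ g : V → ℕ, ∀ v w, f v < f w → g v < g w := by
  classical
  have := Fintype.ofFinite V
  refine ⟨fun v => (Finset.univ.filter fun u => f u < f v).card, fun v w h => ?_⟩
  refine Finset.card_lt_card ((Finset.ssubset_iff_of_subset ?_).2 ⟨v, by simp [h], by simp⟩)
  intro u hu
  simp only [Finset.mem_filter, Finset.mem_univ, true_and] at hu ⊢
  exact hu.trans h

theorem exists_isLinearOrderRel (X : Type*) : ∃ T : X → X → Prop, IsLinearOrderRel T := by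
  classical
  let _ : LinearOrder X := linearOrderOfSTO WellOrderingRel
  exact ⟨(· ≤ ·), le_refl, fun _ _ => le_antisymm, fun _ _ _ => le_trans, le_total⟩

theorem IsLinearOrderRel.flip {X : Type*} {T : X → X → Prop} (h : IsLinearOrderRel T) :
    IsLinearOrderRel fun a b => T b a :=
  ⟨h.1, fun a b h₁ h₂ => h.2.1 a b h₂ h₁, fun a b c h₁ h₂ => h.2.2.1 c b a h₂ h₁,
    fun a b => h.2.2.2 b a⟩

/-- Refine a weighting into a linear order by a tie-breaking linear order. -/
theorem IsLinearOrderRel.refine {X α : Type*} [LinearOrder α] {T : X → X → Prop}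
    (h : IsLinearOrderRel T) (F : X → α) :
    IsLinearOrderRel fun a b => F a < F b ∨ F a = F b ∧ T a b := by
  obtain ⟨h₁, h₂, h₃, h₄⟩ := h
  refine ⟨fun a => Or.inr ⟨rfl, h₁ a⟩, ?_, ?_, ?_⟩
  · rintro a b (h | ⟨e, h⟩) (h' | ⟨e', h'⟩)
    · exact absurd h h'.asymm
    · exact absurd e' h.ne'
    · exact absurd e h'.ne'
    · exact h₂ a b h h'
  · rintro a b c (h | ⟨e, h⟩) (h' | ⟨e', h'⟩)
    · exact Or.inl (h.trans h')
    · exact Or.inl (e' ▸ h)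
    · exact Or.inl (e ▸ h')
    · exact Or.inr ⟨e.trans e', h₃ a b c h h'⟩
  · intro a b
    rcases lt_trichotomy (F a) (F b) with h | h | h
    · exact Or.inl (Or.inl h)
    · exact (h₄ a b).imp (fun t => Or.inr ⟨h, t⟩) (fun t => Or.inr ⟨h.symm, t⟩)
    · exact Or.inr (Or.inl h)

/-- A containment order of nonempty finite sets has dimension at most the number of weightings
of the ground set needed to separate every set from the sets not containing it. -/
theorem dimLE_of_weightings {V X ι : Type*} [Fintype V] [PartialOrder X] [Fintype ι]
    (M : X → Set V) (hne : ∀ x, (M x).Nonempty) (hM : ∀ x y, x ≠ y → (x ≤ y ↔ M x ⊂ M y))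
    (f : ι → V → ℕ) (i₀ i₁ : ι) (hi : i₀ ≠ i₁)
    (hf : ∀ x y, ¬ M x ⊆ M y → ∃ i, ∃ v ∈ M x, ∀ w ∈ M y, f i w < f i v) :
    DimLE X (Fintype.card ι) := by
  classical
  obtain ⟨T, hT⟩ := exists_isLinearOrderRel X
  let F : ι → X → ℕ ×ₗ ℕ := fun i x => toLex ((M x).toFinset.sup (f i), (M x).toFinset.card)
  let T' : ι → X → X → Prop := fun i a b => if i = i₀ then T a b else T b a
  have hT' : ∀ i, IsLinearOrderRel (T' i) := fun i => by
    by_cases h : i = i₀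
    · simpa [T', h] using hT
    · simpa [T', h] using hT.flip
  let e := Fintype.equivFin ι
  refine ⟨fun k a b => F (e.symm k) a < F (e.symm k) b ∨
    F (e.symm k) a = F (e.symm k) b ∧ T' (e.symm k) a b,
    fun k => (hT' _).refine (F (e.symm k)), fun a b => ?_⟩
  by_cases hab : a = b
  · subst hab
    simp [(hT' _).1]
  rw [hM a b hab]
  constructor
  · intro h k
    have hsub : (M a).toFinset ⊂ (M b).toFinset := by simpa using h
    left
    rw [Prod.Lex.toLex_lt_toLex]
    rcases (Finset.sup_mono (f := f (e.symm k)) hsub.subset).lt_or_eq with h' | h'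
    · exact Or.inl h'
    · exact Or.inr ⟨h', Finset.card_lt_card hsub⟩
  · intro h
    replace h : ∀ i, F i a < F i b ∨ F i a = F i b ∧ T' i a b := fun i => by simpa using h (e i)
    by_cases hsub : M a ⊆ M b
    · refine hsub.ssubset_of_ne fun he => hab ?_
      have hF : ∀ i, F i a = F i b := fun i => by simp [F, he]
      have h₀ := (h i₀).resolve_left (hF i₀).not_lt
      have h₁ := (h i₁).resolve_left (hF i₁).not_lt
      exact hT.2.1 a b (by simpa [T'] using h₀.2) (by simpa [T', hi.symm] using h₁.2)
    · obtain ⟨i, v, hv, hlt⟩ := hf a b hsub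
      have hsup : (M b).toFinset.sup (f i) < (M a).toFinset.sup (f i) := by
        obtain ⟨w, hw⟩ := hne b
        have hpos : ⊥ < f i v := (Nat.zero_le _).trans_lt (hlt w hw)
        refine lt_of_lt_of_le ((Finset.sup_lt_iff hpos).2 fun w hw => hlt w (by simpa using hw))
          (Finset.le_sup (f := f i) (by simpa using hv))
      have hgt : F i b < F i a := by
        rw [Prod.Lex.toLex_lt_toLex]
        exact Or.inl hsup
      rcases h i with h' | h'
      · exact absurd h' hgt.asymm
      · exact absurd h'.1 hgt.ne'

/-- If a poset admits a containment model by paths in a host tree of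
maximum degree `Δ ≥ 2` and radius `r ≥ 1`, then its dimension is at most
`2⌈log₂ log₂ Δ⌉ + 2⌈log₂ r⌉ + 3`. -/
theorem dim_CPT_poset {V : Type} [Fintype V] [DecidableEq V]
    (G : SimpleGraph V) [DecidableRel G.Adj] (hT : G.IsTree)
    (Δ r : ℕ) (hΔ : 2 ≤ Δ) (hr : 1 ≤ r)
    (hdeg : G.maxDegree = Δ) (hrad : graphRadius G = r)
    {X : Type} [PartialOrder X] (M : X → Set V) (hM : GraphCPTModel G M) :
    DimLE X (2 * Nat.clog 2 (Nat.clog 2 Δ) + 2 * Nat.clog 2 r + 3) := by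
  obtain ⟨c, hc⟩ : ∃ c : V, ∀ v, G.dist c v ≤ r := by
    have hne : {e | ∃ c : V, ∀ v, G.dist c v ≤ e}.Nonempty := by
      by_contra hempty
      rw [Set.not_nonempty_iff_eq_empty] at hempty
      rw [graphRadius, hempty, Nat.sInf_empty] at hrad
      omega
    have hmem := Nat.sInf_mem hne
    rw [← graphRadius, hrad] at hmem
    exact hmem
  set m := Nat.clog 2 Δ with hm
  have hm0 : 0 < m := Nat.clog_pos (by norm_num) hΔ
  set K := Nat.clog 2 m + Nat.clog 2 r with hK
  have hN : r * m ≤ 2 ^ K := by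
    rw [hK, pow_add, Nat.mul_comm]
    exact Nat.mul_le_mul (Nat.le_pow_clog (by norm_num) _) (Nat.le_pow_clog (by norm_num) _)
  obtain ⟨lab, hlab, hinj⟩ := exists_labels G (m := m)
    (by rw [hdeg]; exact Nat.le_pow_clog (by norm_num) _)
  have hrank : ∀ s : ℕ → Bool, ∃ g : V → ℕ, ∀ v w,
      twist s (pairCode lab (rootSupport hT c v)) < twist s (pairCode lab (rootSupport hT c w)) →
        g v < g w := fun s => exists_rank _
  choose g hg using hrank
  have hcard : Fintype.card (Option (Bool × Option (Fin K))) =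
      2 * Nat.clog 2 m + 2 * Nat.clog 2 r + 3 := by
    simp only [Fintype.card_option, Fintype.card_prod, Fintype.card_bool, Fintype.card_fin]
    omega
  rw [← hcard]
  let f : Option (Bool × Option (Fin K)) → V → ℕ
    | none => fun v => r - G.dist c v
    | some (b, o) => g (signVector b o)
  refine dimLE_of_weightings M (fun x => ?_) hM.2 f none (some (true, none)) (by simp)
    fun x y hxy => ?_
  · obtain ⟨u, v, p, -, e⟩ := hM.1 x
    exact ⟨u, by simp [e]⟩
  · obtain ⟨v, hvx, hvy⟩ := Set.not_subset.1 hxy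
    obtain ⟨u, u', p, hp, e⟩ := hM.1 y
    have hvp : v ∉ p.support := by simpa [e] using hvy
    have hdepth : (∀ w ∈ p.support, G.dist c v < G.dist c w) →
        ∃ i, ∃ v ∈ M x, ∀ w ∈ M y, f i w < f i v := by
      refine fun h => ⟨none, v, hvx, fun w hw => ?_⟩
      have h₁ := h w (by simpa [e] using hw)
      have h₂ := hc w
      simp only [f]
      omega
    by_cases hu : v ∈ rootSupport hT c u
    · exact hdepth fun w hw => dist_lt_of_notMem_path hT c p hu hvp hw
    by_cases hu' : v ∈ rootSupport hT c u'
    · exact hdepth fun w hw => dist_lt_of_notMem_path hT c p.reverse hu' (by simpa using hvp)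
        (by simpa using hw)
    obtain ⟨n, hn, h₁⟩ := exists_position hT c hm0 hN (by positivity) hc hlab hinj u v hu
    obtain ⟨n', hn', h₂⟩ := exists_position hT c hm0 hN (by positivity) hc hlab hinj u' v hu'
    obtain ⟨b, o, hb, hb'⟩ := exists_signVector hn hn'
      fun i => !(pairCode lab (rootSupport hT c v)).getD i false
    refine ⟨some (b, o), v, hvx, fun w hw => hg _ _ _ ?_⟩
    rw [e] at hw
    rcases mem_rootSupport_or_of_mem_path hT c p hp hw with h | h
    · exact h₁ _ hb w h
    · exact h₂ _ hb' w h
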